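/- (Theorem 4, model selection consistency of BIC under spherically symmetric errors.) Under the consistency setup, for every γ ⊆ {1,…,p} with γ ≠ T (the null model γ = ∅ included), the ratio of BIC-based Bayes factors tends to zero in probability: for every δ > 0, lim_{n→∞} 𝒫( R_T² and R_γ² are defined with R_γ² < 1, and n^{(q_T − q_γ)/2} ((1 − R_T²)/(1 − R_γ²))^{n/2} ≤ δ ) = 1. -/

import Mathlib

open MeasureTheory Matrix Filter ENNReal

/-- The submatrix of `X` consisting of the columns indexed by `γ`. -/
noncomputable def designSub {n p : ℕ} (X : Matrix (Fin n) (Fin p) ℝ)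
    (γ : Finset (Fin p)) : Matrix (Fin n) {j // j ∈ γ} ℝ :=
  Matrix.of fun i j => X i (j : Fin p)

/-- The residual projector `Q_γ = I - X_γ(X_γᵀX_γ)⁻¹X_γᵀ` of the submodel `γ`. -/
noncomputable def residProj {n p : ℕ} (X : Matrix (Fin n) (Fin p) ℝ)
    (γ : Finset (Fin p)) : Matrix (Fin n) (Fin n) ℝ :=
  1 - designSub X γ * ((designSub X γ)ᵀ * designSub X γ)⁻¹ * (designSub X γ)ᵀ

/-- The coefficient of determination
`R_γ² = 1 - ‖Q_γ(y-ȳ1)‖²/‖y-ȳ1‖²` of the submodel `γ`. -/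
noncomputable def RsqC {n p : ℕ} (X : Matrix (Fin n) (Fin p) ℝ) (γ : Finset (Fin p))
    (y : Fin n → ℝ) : ℝ :=
  1 - (∑ i, ((residProj X γ).mulVec (fun j => y j - (∑ l, y l) / n) i) ^ 2)
      / (∑ i, (y i - (∑ l, y l) / n) ^ 2)

/-- The response `y = α_T 1 + X β_T + σ_T ε` of the true model. -/
noncomputable def yResp {n p : ℕ} (X : Matrix (Fin n) (Fin p) ℝ) (αT : ℝ)
    (βT : Fin p → ℝ) (σT : ℝ) (ε : Fin n → ℝ) : Fin n → ℝ :=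
  fun i => αT + X.mulVec βT i + σT * ε i


lemma designSub_mulVec {n p : ℕ} (X : Matrix (Fin n) (Fin p) ℝ) (γ : Finset (Fin p))
    (b : {j // j ∈ γ} → ℝ) :
    designSub X γ *ᵥ b = X *ᵥ (fun j => if h : j ∈ γ then b ⟨j, h⟩ else 0) := by
  ext i
  simp only [mulVec, dotProduct, designSub, Matrix.of_apply]
  rw [← Finset.sum_subset (Finset.subset_univ γ) (by intro j _ hj; simp [hj]),
    ← Finset.sum_coe_sort γ]
  exact Finset.sum_congr rfl fun j _ => by simp

lemma isUnit_gram_designSub {n p : ℕ} {X : Matrix (Fin n) (Fin p) ℝ}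
    (hX : ∀ d, X *ᵥ d = 0 → d = 0) (γ : Finset (Fin p)) :
    IsUnit ((designSub X γ)ᵀ * designSub X γ).det := by
  have hinj : Function.Injective (designSub X γ).mulVec := by
    refine (injective_iff_map_eq_zero (designSub X γ).mulVecLin).2 fun b hb => ?_
    rw [mulVecLin_apply, designSub_mulVec] at hb
    ext j
    simpa using congrFun (hX _ hb) j
  have := PosDef.conjTranspose_mul_self (designSub X γ) hinj
  rw [conjTranspose_eq_transpose_of_trivial] at this
  exact (ne_of_gt this.det_pos).isUnit

/-- The residual is a response minus a fitted value from the submodel. -/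
lemma residProj_mulVec_eq_sub {n p : ℕ} (X : Matrix (Fin n) (Fin p) ℝ) (γ : Finset (Fin p))
    (v : Fin n → ℝ) :
    ∃ b : Fin p → ℝ, (∀ j ∉ γ, b j = 0) ∧ residProj X γ *ᵥ v = v - X *ᵥ b := by
  refine ⟨fun j => if h : j ∈ γ then
    (((designSub X γ)ᵀ * designSub X γ)⁻¹ *ᵥ ((designSub X γ)ᵀ *ᵥ v)) ⟨j, h⟩ else 0,
    fun j hj => by simp [hj], ?_⟩
  rw [residProj, sub_mulVec, one_mulVec, Matrix.mul_assoc, ← mulVec_mulVec, ← mulVec_mulVec,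
    designSub_mulVec]

/-- The residual is orthogonal to every regressor of the submodel. -/
lemma transpose_mulVec_residProj {n p : ℕ} {X : Matrix (Fin n) (Fin p) ℝ}
    (hX : ∀ d, X *ᵥ d = 0 → d = 0) (γ : Finset (Fin p)) (v : Fin n → ℝ) {j : Fin p}
    (hj : j ∈ γ) : (Xᵀ *ᵥ (residProj X γ *ᵥ v)) j = 0 := by
  have h : (designSub X γ)ᵀ * residProj X γ = 0 := by
    rw [residProj, Matrix.mul_sub, Matrix.mul_one, ← Matrix.mul_assoc, ← Matrix.mul_assoc,
      Matrix.mul_nonsing_inv _ (isUnit_gram_designSub hX γ), Matrix.one_mul, sub_self]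
  have hj0 := congrFun (congrArg (· *ᵥ v) h) ⟨j, hj⟩
  simp only [← mulVec_mulVec, zero_mulVec] at hj0
  exact hj0

/-- The residual sum of squares is minimal among all fits from the submodel. -/
lemma sum_residProj_sq_le {n p : ℕ} {X : Matrix (Fin n) (Fin p) ℝ}
    (hX : ∀ d, X *ᵥ d = 0 → d = 0) (γ : Finset (Fin p)) (v : Fin n → ℝ) {b : Fin p → ℝ}
    (hb : ∀ j ∉ γ, b j = 0) :
    ∑ i, (residProj X γ *ᵥ v) i ^ 2 ≤ ∑ i, (v - X *ᵥ b) i ^ 2 := by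
  obtain ⟨b₀, hb₀, h₀⟩ := residProj_mulVec_eq_sub X γ v
  have horth : (residProj X γ *ᵥ v) ⬝ᵥ (X *ᵥ (b₀ - b)) = 0 := by
    rw [dotProduct_mulVec, ← mulVec_transpose]
    refine Finset.sum_eq_zero fun j _ => ?_
    by_cases hj : j ∈ γ
    · rw [transpose_mulVec_residProj hX γ v hj, zero_mul]
    · simp [hb j hj, hb₀ j hj]
  have hv : v - X *ᵥ b = residProj X γ *ᵥ v + X *ᵥ (b₀ - b) := by
    rw [h₀, mulVec_sub]; abel
  have hexp : ∑ i, (v - X *ᵥ b) i ^ 2 = ∑ i, (residProj X γ *ᵥ v) i ^ 2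
      + 2 * ((residProj X γ *ᵥ v) ⬝ᵥ (X *ᵥ (b₀ - b))) + ∑ i, (X *ᵥ (b₀ - b)) i ^ 2 := by
    rw [hv, dotProduct, Finset.mul_sum, ← Finset.sum_add_distrib, ← Finset.sum_add_distrib]
    exact Finset.sum_congr rfl fun i _ => by simp only [Pi.add_apply]; ring
  rw [hexp, horth]
  have : 0 ≤ ∑ i, (X *ᵥ (b₀ - b)) i ^ 2 := Finset.sum_nonneg fun i _ => sq_nonneg _
  linarith

lemma abs_dotProduct_le_norm_mul_sum {p : ℕ} (d u : Fin p → ℝ) :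
    |d ⬝ᵥ u| ≤ ‖d‖ * ∑ j, |u j| := by
  rw [dotProduct, Finset.mul_sum]
  refine (Finset.abs_sum_le_sum_abs _ _).trans (Finset.sum_le_sum fun j _ => ?_)
  rw [abs_mul]
  exact mul_le_mul_of_nonneg_right (norm_le_pi_norm d j) (abs_nonneg _)

lemma Matrix.PosDef.exists_mul_norm_sq_le {p : ℕ} {S : Matrix (Fin p) (Fin p) ℝ} (hS : S.PosDef) :
    ∃ c : ℝ, 0 < c ∧ ∀ d : Fin p → ℝ, c * ‖d‖ ^ 2 ≤ d ⬝ᵥ S *ᵥ d := by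
  have hpos : ∀ d : Fin p → ℝ, d ≠ 0 → 0 < d ⬝ᵥ S *ᵥ d := fun d hd => by
    simpa using hS.dotProduct_mulVec_pos hd
  have hcont : Continuous fun d : Fin p → ℝ => d ⬝ᵥ S *ᵥ d := by
    unfold dotProduct mulVec dotProduct
    fun_prop
  rcases (Metric.sphere (0 : Fin p → ℝ) 1).eq_empty_or_nonempty with hE | hE
  · refine ⟨1, one_pos, fun d => ?_⟩
    have hd : d = 0 := by
      by_contra hd
      have : ‖d‖⁻¹ • d ∈ Metric.sphere (0 : Fin p → ℝ) 1 := by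
        simp [norm_smul, norm_ne_zero_iff.2 hd]
      simp [hE] at this
    simp [hd]
  · obtain ⟨x, hx, hmin⟩ := (isCompact_sphere (0 : Fin p → ℝ) 1).exists_isMinOn hE
      hcont.continuousOn
    have hx0 : x ≠ 0 := by
      rintro rfl
      simp at hx
    refine ⟨x ⬝ᵥ S *ᵥ x, hpos x hx0, fun d => ?_⟩
    by_cases hd : d = 0
    · simp [hd]
    have hd' : 0 < ‖d‖ := norm_pos_iff.2 hd
    have hm : ‖d‖⁻¹ • d ∈ Metric.sphere (0 : Fin p → ℝ) 1 := by
      simp [norm_smul, hd'.ne']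
    have h := isMinOn_iff.1 hmin _ hm
    rw [mulVec_smul, dotProduct_smul, smul_dotProduct, smul_eq_mul, smul_eq_mul] at h
    calc x ⬝ᵥ S *ᵥ x * ‖d‖ ^ 2
        ≤ (‖d‖⁻¹ * (‖d‖⁻¹ * (d ⬝ᵥ S *ᵥ d))) * ‖d‖ ^ 2 := by gcongr
      _ = d ⬝ᵥ S *ᵥ d := by field_simp

lemma abs_quadForm_le {p : ℕ} (S : Matrix (Fin p) (Fin p) ℝ) (d : Fin p → ℝ) :
    |d ⬝ᵥ S *ᵥ d| ≤ (∑ i, ∑ j, |S i j|) * ‖d‖ ^ 2 := by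
  refine (abs_dotProduct_le_norm_mul_sum d _).trans ?_
  have : ∑ i, |(S *ᵥ d) i| ≤ (∑ i, ∑ j, |S i j|) * ‖d‖ := by
    rw [Finset.sum_mul]
    refine Finset.sum_le_sum fun i _ => ?_
    rw [mulVec, dotProduct_comm, mul_comm]
    exact abs_dotProduct_le_norm_mul_sum d _
  calc ‖d‖ * ∑ i, |(S *ᵥ d) i| ≤ ‖d‖ * ((∑ i, ∑ j, |S i j|) * ‖d‖) := by gcongr
    _ = _ := by ring

/-- Uniform coercivity of the Gram matrices. -/
lemma eventually_mul_norm_sq_le_gram {p : ℕ} {X : (n : ℕ) → Matrix (Fin n) (Fin p) ℝ}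
    {S₀ : Matrix (Fin p) (Fin p) ℝ} (hS₀ : S₀.PosDef)
    (hlim : Tendsto (fun n : ℕ => ((n : ℝ)⁻¹) • ((X n)ᵀ * X n)) atTop (nhds S₀)) :
    ∃ c : ℝ, 0 < c ∧ ∀ᶠ n : ℕ in atTop, ∀ d : Fin p → ℝ,
      c * n * ‖d‖ ^ 2 ≤ ∑ i, (X n *ᵥ d) i ^ 2 := by
  obtain ⟨c, hc, hle⟩ := hS₀.exists_mul_norm_sq_le
  refine ⟨c / 2, half_pos hc, ?_⟩
  have hE : Tendsto (fun n : ℕ => ∑ i, ∑ j, |(((n : ℝ)⁻¹) • ((X n)ᵀ * X n) - S₀) i j|)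
      atTop (nhds 0) := by
    have hcont : Continuous fun S : Matrix (Fin p) (Fin p) ℝ => ∑ i, ∑ j, |(S - S₀) i j| := by
      simp only [Matrix.sub_apply]
      fun_prop
    have h := (hcont.tendsto S₀).comp hlim
    simp only [sub_self, Matrix.zero_apply, abs_zero, Finset.sum_const_zero] at h
    exact h
  filter_upwards [hE.eventually_lt_const (half_pos hc), eventually_gt_atTop 0] with n hn hn0 d
  have hn0' : (0 : ℝ) < n := Nat.cast_pos.2 hn0
  have h1 := (abs_le.1 (abs_quadForm_le (((n : ℝ)⁻¹) • ((X n)ᵀ * X n) - S₀) d)).1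
  rw [sub_mulVec, dotProduct_sub, smul_mulVec, dotProduct_smul, smul_eq_mul] at h1
  have h2 : d ⬝ᵥ ((X n)ᵀ * X n) *ᵥ d = ∑ i, (X n *ᵥ d) i ^ 2 := by
    rw [← mulVec_mulVec, dotProduct_mulVec, vecMul_transpose]
    exact Finset.sum_congr rfl fun i _ => (sq _).symm
  have h3 := mul_le_mul_of_nonneg_right hn.le (sq_nonneg ‖d‖)
  have h4 : c / 2 * ‖d‖ ^ 2 ≤ (n : ℝ)⁻¹ * ∑ i, (X n *ᵥ d) i ^ 2 := by
    rw [← h2]; linarith [hle d]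
  rw [inv_mul_eq_div, le_div_iff₀ hn0'] at h4
  linarith

/-- Second moment of a linear functional of isotropic noise. -/
lemma integral_dotProduct_sq {n : ℕ} {Ω : Type*} [MeasurableSpace Ω] {P : Measure Ω}
    {ε : Ω → Fin n → ℝ} (hε : Measurable ε)
    (hcov : ∀ i j, ∫ ω, ε ω i * ε ω j ∂P = if i = j then 1 else 0) (a : Fin n → ℝ) :
    Integrable (fun ω => (a ⬝ᵥ ε ω) ^ 2) P ∧ ∫ ω, (a ⬝ᵥ ε ω) ^ 2 ∂P = ∑ i, a i ^ 2 := by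
  have hm : ∀ i, Measurable fun ω => ε ω i := fun i => (measurable_pi_apply i).comp hε
  have hL2 : ∀ i, MemLp (fun ω => ε ω i) 2 P := fun i => by
    rw [memLp_two_iff_integrable_sq (hm i).aestronglyMeasurable]
    by_contra h
    have := hcov i i
    simp only [← sq, integral_undef h] at this
    simp at this
  have hI : ∀ i j, Integrable (fun ω => ε ω i * ε ω j) P :=
    fun i j => (hL2 i).integrable_mul (hL2 j)
  have hexp : (fun ω => (a ⬝ᵥ ε ω) ^ 2)
      = fun ω => ∑ i, ∑ j, a i * a j * (ε ω i * ε ω j) := by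
    ext ω
    rw [sq, dotProduct, Finset.sum_mul_sum]
    exact Finset.sum_congr rfl fun i _ => Finset.sum_congr rfl fun j _ => by ring
  have hI' : ∀ i j, Integrable (fun ω => a i * a j * (ε ω i * ε ω j)) P :=
    fun i j => (hI i j).const_mul _
  rw [hexp]
  refine ⟨integrable_finsetSum _ fun i _ => integrable_finsetSum _ fun j _ => hI' i j, ?_⟩
  rw [integral_finsetSum _ fun i _ => integrable_finsetSum _ fun j _ => hI' i j]
  refine Finset.sum_congr rfl fun i _ => ?_
  rw [integral_finsetSum _ fun j _ => hI' i j]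
  simp [integral_const_mul, hcov, sq]

lemma yResp_sub_mean {n p : ℕ} {X : Matrix (Fin n) (Fin p) ℝ} (hX : ∀ j, ∑ i, X i j = 0)
    (hn : 0 < n) (α σ : ℝ) (β : Fin p → ℝ) (e : Fin n → ℝ) :
    (fun i => yResp X α β σ e i - (∑ l, yResp X α β σ e l) / n)
      = X *ᵥ β + σ • fun i => e i - (∑ l, e l) / n := by
  have h0 : ∑ i, (X *ᵥ β) i = 0 := by
    simp only [mulVec, dotProduct]
    rw [Finset.sum_comm]
    simp [← Finset.sum_mul, hX]
  have hn' : (n : ℝ) ≠ 0 := (Nat.cast_pos.2 hn).ne'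
  ext i
  simp only [yResp, Finset.sum_add_distrib, h0, ← Finset.mul_sum, Finset.sum_const,
    Finset.card_univ, Fintype.card_fin, nsmul_eq_mul, Pi.add_apply, Pi.smul_apply, smul_eq_mul]
  field_simp
  ring

lemma sum_sub_mean_sq {n : ℕ} (hn : 0 < n) (e : Fin n → ℝ) :
    ∑ i, (e i - (∑ l, e l) / n) ^ 2 = ∑ i, e i ^ 2 - (∑ l, e l) ^ 2 / n := by
  have hn' : (n : ℝ) ≠ 0 := (Nat.cast_pos.2 hn).ne'
  simp only [sub_sq, Finset.sum_add_distrib, Finset.sum_sub_distrib, ← Finset.sum_mul,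
    ← Finset.mul_sum, Finset.sum_const, Finset.card_univ, Fintype.card_fin, nsmul_eq_mul]
  field_simp
  ring

/-- Lower bound for the distance between a noisy signal and a fitted value. -/
lemma le_sum_mulVec_add_smul_sq {n p : ℕ} {X : Matrix (Fin n) (Fin p) ℝ}
    (hX : ∀ j, ∑ i, X i j = 0) (hn : 0 < n) {c : ℝ} (hc : 0 < c)
    (hgram : ∀ d : Fin p → ℝ, c * n * ‖d‖ ^ 2 ≤ ∑ i, (X *ᵥ d) i ^ 2)
    {K σ : ℝ} (hσ : 0 < σ) {e : Fin n → ℝ} (hK : ∑ j, (Xᵀ *ᵥ e) j ^ 2 ≤ K * n)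
    (d : Fin p → ℝ) :
    σ ^ 2 * ∑ i, (e i - (∑ l, e l) / n) ^ 2 + c * n * ‖d‖ ^ 2 / 2 - 2 * σ ^ 2 * (p * K) / c
      ≤ ∑ i, (X *ᵥ d + σ • fun i => e i - (∑ l, e l) / n) i ^ 2 := by
  have hn' : (0 : ℝ) < n := Nat.cast_pos.2 hn
  set w : Fin n → ℝ := fun i => e i - (∑ l, e l) / n with hw
  have hXw : Xᵀ *ᵥ w = Xᵀ *ᵥ e := by
    ext j
    simp [hw, mulVec, dotProduct, mul_sub, ← Finset.sum_mul, hX]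
  have hcross : (X *ᵥ d) ⬝ᵥ w = d ⬝ᵥ (Xᵀ *ᵥ e) := by
    rw [← hXw, dotProduct_mulVec, vecMul_transpose]
  have hexp : ∑ i, (X *ᵥ d + σ • w) i ^ 2
      = ∑ i, (X *ᵥ d) i ^ 2 + 2 * σ * ((X *ᵥ d) ⬝ᵥ w) + σ ^ 2 * ∑ i, w i ^ 2 := by
    rw [dotProduct, Finset.mul_sum, Finset.mul_sum, ← Finset.sum_add_distrib,
      ← Finset.sum_add_distrib]
    exact Finset.sum_congr rfl fun i _ => by
      simp only [Pi.add_apply, Pi.smul_apply, smul_eq_mul]; ring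
  set W := ∑ j, |(Xᵀ *ᵥ e) j| with hW
  have hW2 : W ^ 2 ≤ p * (K * n) := by
    refine (sq_sum_le_card_mul_sum_sq (s := Finset.univ)
      (f := fun j => |(Xᵀ *ᵥ e) j|)).trans ?_
    simp only [sq_abs, Finset.card_univ, Fintype.card_fin]
    gcongr
  have hd := (abs_le.1 (abs_dotProduct_le_norm_mul_sum d (Xᵀ *ᵥ e))).1
  rw [hexp, hcross]
  have hamgm : 2 * σ * (‖d‖ * W) ≤ c * n * ‖d‖ ^ 2 / 2 + 2 * σ ^ 2 * (p * K) / c := by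
    have h1 : 2 * σ ^ 2 * W ^ 2 / (c * n) ≤ 2 * σ ^ 2 * (p * K) / c := by
      rw [div_le_div_iff₀ (by positivity) hc]
      nlinarith [mul_le_mul_of_nonneg_left hW2 (show 0 ≤ 2 * σ ^ 2 * c by positivity)]
    have h2 : 2 * σ * (‖d‖ * W) ≤ c * n * ‖d‖ ^ 2 / 2 + 2 * σ ^ 2 * W ^ 2 / (c * n) := by
      have h3 : c * n * ‖d‖ ^ 2 / 2 + 2 * σ ^ 2 * W ^ 2 / (c * n) - 2 * σ * (‖d‖ * W)
          = (c * n * ‖d‖ - 2 * σ * W) ^ 2 / (2 * (c * n)) := by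
        field_simp
        ring
      have : 0 ≤ (c * n * ‖d‖ - 2 * σ * W) ^ 2 / (2 * (c * n)) := by positivity
      linarith
    linarith
  have h4 := mul_le_mul_of_nonneg_left hd (show 0 ≤ 2 * σ by positivity)
  have h5 := hgram d
  linarith

lemma eventually_rpow_mul_rpow_div_two_le {ρ δ : ℝ} (hρ0 : 0 < ρ) (hρ1 : ρ < 1) (hδ : 0 < δ)
    (s : ℝ) : ∀ᶠ n : ℕ in atTop, (n : ℝ) ^ s * ρ ^ ((n : ℝ) / 2) ≤ δ := by
  have hb : 0 < -Real.log ρ / 2 := by linarith [Real.log_neg hρ0 hρ1]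
  have h := (tendsto_rpow_mul_exp_neg_mul_atTop_nhds_zero s _ hb).comp
    tendsto_natCast_atTop_atTop
  filter_upwards [h.eventually_le_const hδ] with n hn
  rw [Real.rpow_def_of_pos hρ0,
    show Real.log ρ * ((n : ℝ) / 2) = -(-Real.log ρ / 2) * n by ring]
  exact hn


/-- The ratio bound for a submodel that misses a true regressor. -/
lemma eventually_ratio_le_of_gap {a L A δ : ℝ} (ha : 0 < a) (hL : 0 < L) (hδ : 0 < δ) (s : ℝ) :
    ∀ᶠ n : ℕ in atTop, ∀ B R S : ℝ, 0 ≤ B → B ≤ L * n → 0 ≤ S → S ≤ B →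
      B + a * n - A ≤ R → 0 < R ∧ (n : ℝ) ^ s * (S / R) ^ ((n : ℝ) / 2) ≤ δ := by
  have hρ1 : L / (L + a / 2) < 1 := by rw [div_lt_one (by positivity)]; linarith
  filter_upwards [eventually_rpow_mul_rpow_div_two_le (ρ := L / (L + a / 2)) (by positivity)
    hρ1 hδ s, eventually_gt_atTop 0, tendsto_natCast_atTop_atTop.eventually_ge_atTop (2 * A / a)]
    with n hn hn0 hnA B R S hB hBL hS hSB hR
  have hn0' : (0 : ℝ) < n := Nat.cast_pos.2 hn0
  rw [div_le_iff₀ ha] at hnA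
  have hR' : B + a / 2 * n ≤ R := by linarith
  have hRpos : 0 < R := lt_of_lt_of_le (by positivity) hR'
  refine ⟨hRpos, le_trans ?_ hn⟩
  have hle : S / R ≤ L / (L + a / 2) := by
    rw [div_le_div_iff₀ hRpos (by positivity)]
    nlinarith [mul_le_mul_of_nonneg_left hR' hL.le,
      mul_le_mul_of_nonneg_right hSB (show 0 ≤ L + a / 2 by positivity),
      mul_le_mul_of_nonneg_left hBL (show 0 ≤ a / 2 by positivity)]
  gcongr

/-- The ratio bound for an overfitted submodel. -/
lemma eventually_ratio_le_of_neg {a A δ s : ℝ} (ha : 0 < a) (hA : 0 ≤ A) (hδ : 0 < δ)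
    (hs : s < 0) :
    ∀ᶠ n : ℕ in atTop, ∀ B R S : ℝ, a * n ≤ B → 0 ≤ S → S ≤ B → B - A ≤ R →
      0 < R ∧ (n : ℝ) ^ s * (S / R) ^ ((n : ℝ) / 2) ≤ δ := by
  have hlim : Tendsto (fun n : ℕ => (n : ℝ) ^ s * Real.exp (A / a)) atTop (nhds 0) := by
    have h := (tendsto_rpow_neg_atTop (neg_pos.2 hs)).comp
      (tendsto_natCast_atTop_atTop (R := ℝ))
    simpa using h.mul_const (Real.exp (A / a))
  filter_upwards [hlim.eventually_le_const hδ, eventually_gt_atTop 0,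
    tendsto_natCast_atTop_atTop.eventually_ge_atTop (2 * A / a)]
    with n hn hn0 hnA B R S hB hS hSB hR
  have hn0' : (0 : ℝ) < n := Nat.cast_pos.2 hn0
  rw [div_le_iff₀ ha] at hnA
  have hD : a * n / 2 ≤ B - A := by linarith
  have hDpos : 0 < B - A := lt_of_lt_of_le (by positivity) hD
  have hRpos : 0 < R := hDpos.trans_le hR
  refine ⟨hRpos, le_trans ?_ hn⟩
  have hle : S / R ≤ Real.exp (2 * A / (a * n)) := by
    calc S / R ≤ B / (B - A) := div_le_div₀ (hS.trans hSB) hSB hDpos hR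
      _ = A / (B - A) + 1 := by field_simp; ring
      _ ≤ A / (a * n / 2) + 1 := by gcongr
      _ = 2 * A / (a * n) + 1 := by field_simp
      _ ≤ _ := Real.add_one_le_exp _
  calc (n : ℝ) ^ s * (S / R) ^ ((n : ℝ) / 2)
      ≤ (n : ℝ) ^ s * Real.exp (2 * A / (a * n)) ^ ((n : ℝ) / 2) := by gcongr
    _ = (n : ℝ) ^ s * Real.exp (A / a) := by
      rw [← Real.exp_mul]
      congr 2
      field_simp

/-- A positive residual sum of squares makes `R²` well defined and smaller than one, and turns the
ratio of `1 - R²` into a ratio of residual sums of squares. -/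
lemma RsqC_lt_one_and_div_eq {n p : ℕ} {X : Matrix (Fin n) (Fin p) ℝ}
    (hX : ∀ d, X *ᵥ d = 0 → d = 0) (γ T : Finset (Fin p)) (y : Fin n → ℝ)
    (hpos : 0 < ∑ i, (residProj X γ *ᵥ (fun j => y j - (∑ l, y l) / n)) i ^ 2) :
    (∑ i, (y i - (∑ l, y l) / n) ^ 2) ≠ 0 ∧ RsqC X γ y < 1 ∧
      (1 - RsqC X T y) / (1 - RsqC X γ y)
        = (∑ i, (residProj X T *ᵥ (fun j => y j - (∑ l, y l) / n)) i ^ 2) /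
          ∑ i, (residProj X γ *ᵥ (fun j => y j - (∑ l, y l) / n)) i ^ 2 := by
  have hV : 0 < ∑ i, (y i - (∑ l, y l) / n) ^ 2 := by
    have h := sum_residProj_sq_le hX γ (fun j => y j - (∑ l, y l) / n) (b := 0) (by simp)
    simp only [mulVec_zero, sub_zero] at h
    exact hpos.trans_le h
  refine ⟨hV.ne', ?_, ?_⟩
  · rw [RsqC, sub_lt_self_iff]
    exact div_pos hpos hV
  · rw [RsqC, RsqC, sub_sub_self, sub_sub_self, div_div_div_cancel_right₀ (ne_of_gt hV)]

/-- On the event where the noise is well behaved, the Bayes factor ratio is eventually small. -/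
lemma eventually_bayesFactorRatio_le {p : ℕ} {X : (n : ℕ) → Matrix (Fin n) (Fin p) ℝ}
    (horth : ∀ n j, ∑ i, X n i j = 0) {c : ℝ} (hc : 0 < c)
    (hgram : ∀ᶠ n : ℕ in atTop, ∀ d : Fin p → ℝ, c * n * ‖d‖ ^ 2 ≤ ∑ i, (X n *ᵥ d) i ^ 2)
    {T : Finset (Fin p)} (α : ℝ) {σ : ℝ} (hσ : 0 < σ) {β : Fin p → ℝ}
    (hβ : ∀ j ∈ T, β j ≠ 0) (hβ' : ∀ j ∉ T, β j = 0) {γ : Finset (Fin p)} (hγT : γ ≠ T)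
    {M K : ℝ} (hM : 1 < M) (hK : 0 < K) {δ : ℝ} (hδ : 0 < δ) :
    ∀ᶠ n : ℕ in atTop, ∀ e : Fin n → ℝ,
      M⁻¹ < (∑ i, e i ^ 2) / n → (∑ i, e i ^ 2) / n < M →
      ∑ j, ((X n)ᵀ *ᵥ e) j ^ 2 ≤ K * n → (∑ i, e i) ^ 2 ≤ K * n →
      (∑ i, (yResp (X n) α β σ e i - (∑ l, yResp (X n) α β σ e l) / n) ^ 2) ≠ 0 ∧
      RsqC (X n) γ (yResp (X n) α β σ e) < 1 ∧
      (n : ℝ) ^ (((T.card : ℝ) - γ.card) / 2) *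
        ((1 - RsqC (X n) T (yResp (X n) α β σ e)) /
          (1 - RsqC (X n) γ (yResp (X n) α β σ e))) ^ ((n : ℝ) / 2) ≤ δ := by
  have hM0 : 0 < M := one_pos.trans hM
  set A : ℝ := 2 * σ ^ 2 * (p * K) / c with hA
  have hA0 : 0 ≤ A := by positivity
  have hev : ∀ᶠ n : ℕ in atTop, ∀ B R S : ℝ, σ ^ 2 / (2 * M) * n ≤ B → B ≤ σ ^ 2 * M * n →
      0 ≤ S → S ≤ B →
      (∃ b : Fin p → ℝ, (∀ j ∉ γ, b j = 0) ∧ B + c * n * ‖β - b‖ ^ 2 / 2 - A ≤ R) →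
      0 < R ∧ (n : ℝ) ^ (((T.card : ℝ) - γ.card) / 2) * (S / R) ^ ((n : ℝ) / 2) ≤ δ := by
    by_cases hsub : T ⊆ γ
    · have hcard : (T.card : ℝ) < γ.card :=
        Nat.cast_lt.2 (Finset.card_lt_card (hsub.ssubset_of_ne hγT.symm))
      filter_upwards [eventually_ratio_le_of_neg (a := σ ^ 2 / (2 * M)) (by positivity) hA0 hδ
        (show ((T.card : ℝ) - γ.card) / 2 < 0 by linarith)] with n hn B R S hB _ hS hSB hR
      obtain ⟨b, -, hR⟩ := hR
      refine hn B R S hB hS hSB (le_trans ?_ hR)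
      have : 0 ≤ c * n * ‖β - b‖ ^ 2 / 2 := by positivity
      linarith
    · obtain ⟨j, hjT, hjγ⟩ := Finset.not_subset.1 hsub
      have hj := abs_pos.2 (hβ j hjT)
      filter_upwards [eventually_ratio_le_of_gap (a := c * |β j| ^ 2 / 2) (A := A)
        (by positivity) (show 0 < σ ^ 2 * M by positivity) hδ (((T.card : ℝ) - γ.card) / 2)]
        with n hn B R S hB hBM hS hSB hR
      obtain ⟨b, hb, hR⟩ := hR
      refine hn B R S (le_trans (by positivity) hB) hBM hS hSB (le_trans ?_ hR)
      have hle : |β j| ≤ ‖β - b‖ := by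
        simpa [hb j hjγ] using norm_le_pi_norm (β - b) j
      have : c * n * |β j| ^ 2 ≤ c * n * ‖β - b‖ ^ 2 := by gcongr
      linarith
  filter_upwards [hev, hgram, eventually_gt_atTop 0,
    tendsto_natCast_atTop_atTop.eventually_ge_atTop (2 * M * K)]
    with n hn hg hn0 hnK e he1 he2 hK1 hK2
  have hn0' : (0 : ℝ) < n := Nat.cast_pos.2 hn0
  have hX : ∀ d, X n *ᵥ d = 0 → d = 0 := fun d hd => by
    have h := hg d
    simp only [hd, Pi.zero_apply, ne_eq, OfNat.ofNat_ne_zero, not_false_eq_true, zero_pow,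
      Finset.sum_const_zero] at h
    have h2 : ‖d‖ ^ 2 ≤ 0 := nonpos_of_mul_nonpos_right h (by positivity)
    exact norm_eq_zero.1 (pow_eq_zero_iff two_ne_zero |>.1 (h2.antisymm (sq_nonneg _)))
  set v : Fin n → ℝ :=
    fun i => yResp (X n) α β σ e i - (∑ l, yResp (X n) α β σ e l) / n with hv
  have hv' := yResp_sub_mean (horth n) hn0 α σ β e
  rw [← hv] at hv'
  have hQ := sum_sub_mean_sq hn0 e
  rw [lt_div_iff₀ hn0'] at he1
  rw [div_lt_iff₀ hn0'] at he2
  have hK2' : (∑ l, e l) ^ 2 / n ≤ K := by rwa [div_le_iff₀ hn0']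
  have hK0 : 0 ≤ (∑ l, e l) ^ 2 / n := by positivity
  obtain ⟨b, hb, hres⟩ := residProj_mulVec_eq_sub (X n) γ v
  have hlow := le_sum_mulVec_add_smul_sq (horth n) hn0 hc hg hσ hK1 (β - b)
  have hup := sum_residProj_sq_le hX T v hβ'
  have hrw : residProj (X n) γ *ᵥ v
      = X n *ᵥ (β - b) + σ • fun i => e i - (∑ l, e l) / n := by
    rw [hres, hv', mulVec_sub]; abel
  rw [← hrw] at hlow
  have hup' : ∑ i, (v - X n *ᵥ β) i ^ 2 = σ ^ 2 * ∑ i, (e i - (∑ l, e l) / n) ^ 2 := by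
    rw [hv', add_sub_cancel_left, Finset.mul_sum]
    exact Finset.sum_congr rfl fun i _ => by simp only [Pi.smul_apply, smul_eq_mul]; ring
  rw [hup'] at hup
  have hB1 : σ ^ 2 / (2 * M) * n ≤ σ ^ 2 * ∑ i, (e i - (∑ l, e l) / n) ^ 2 := by
    have : (n : ℝ) / (2 * M) ≤ ∑ i, (e i - (∑ l, e l) / n) ^ 2 := by
      have h1 : K ≤ n / (2 * M) := by rw [le_div_iff₀ (by positivity)]; linarith
      have h2 : M⁻¹ * n = n / (2 * M) + n / (2 * M) := by field_simp; ring
      linarith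
    calc σ ^ 2 / (2 * M) * n = σ ^ 2 * (n / (2 * M)) := by ring
      _ ≤ _ := by gcongr
  have hB2 : σ ^ 2 * ∑ i, (e i - (∑ l, e l) / n) ^ 2 ≤ σ ^ 2 * M * n := by
    rw [mul_assoc]
    gcongr
    linarith
  obtain ⟨hpos, hle⟩ := hn _ _ _ hB1 hB2 (Finset.sum_nonneg fun i _ => sq_nonneg _) hup
    ⟨b, hb, hlow⟩
  obtain ⟨h1, h2, h3⟩ := RsqC_lt_one_and_div_eq hX γ T (yResp (X n) α β σ e) hpos
  exact ⟨h1, h2, h3 ▸ hle⟩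

/-- The scores `Xᵀε` and `1ᵀε` are of order `√n` in probability. -/
lemma exists_measure_scores_gt_le {p : ℕ} {Ω : Type*} [MeasurableSpace Ω] {P : Measure Ω}
    [IsFiniteMeasure P] {X : (n : ℕ) → Matrix (Fin n) (Fin p) ℝ} {ε : (n : ℕ) → Ω → Fin n → ℝ}
    {S₀ : Matrix (Fin p) (Fin p) ℝ}
    (hlim : Tendsto (fun n : ℕ => ((n : ℝ)⁻¹) • ((X n)ᵀ * X n)) atTop (nhds S₀))
    (hmeas : ∀ n, Measurable (ε n))
    (hcov : ∀ n i j, ∫ ω, ε n ω i * ε n ω j ∂P = if i = j then 1 else 0)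
    {η : ℝ} (hη : 0 < η) :
    ∃ K : ℝ, 0 < K ∧ ∀ᶠ n : ℕ in atTop,
      P {ω | K * n < ∑ j, ((X n)ᵀ *ᵥ ε n ω) j ^ 2 + (∑ i, ε n ω i) ^ 2} ≤ ENNReal.ofReal η := by
  set C : ℝ := |S₀.trace| + 2 with hC
  have hC0 : 0 < C := by positivity
  have htr : Tendsto (fun n : ℕ => (((n : ℝ)⁻¹) • ((X n)ᵀ * X n)).trace) atTop
      (nhds S₀.trace) := by
    have hcont : Continuous fun S : Matrix (Fin p) (Fin p) ℝ => S.trace :=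
      continuous_id.matrix_trace
    exact (hcont.tendsto S₀).comp hlim
  refine ⟨C / η, by positivity, ?_⟩
  filter_upwards [htr.eventually_lt_const (show S₀.trace < |S₀.trace| + 1 by
    linarith [le_abs_self S₀.trace]), eventually_gt_atTop 0] with n hn hn0
  have hn0' : (0 : ℝ) < n := Nat.cast_pos.2 hn0
  have hquad := fun a => integral_dotProduct_sq (hmeas n) (hcov n) a
  have hone : ∀ ω, ∑ i, ε n ω i = (fun _ => (1 : ℝ)) ⬝ᵥ ε n ω := fun ω => by simp [dotProduct]
  have hscore : ∀ ω j, ((X n)ᵀ *ᵥ ε n ω) j = (fun i => X n i j) ⬝ᵥ ε n ω := fun ω j => rfl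
  simp only [hone, hscore]
  have hint : Integrable (fun ω => ∑ j, ((fun i => X n i j) ⬝ᵥ ε n ω) ^ 2) P :=
    integrable_finsetSum _ fun j _ => (hquad _).1
  have hE : ∫ ω, (∑ j, ((fun i => X n i j) ⬝ᵥ ε n ω) ^ 2 + ((fun _ => (1 : ℝ)) ⬝ᵥ ε n ω) ^ 2) ∂P
      ≤ C * n := by
    rw [integral_add hint (hquad _).1, integral_finsetSum _ fun j _ => (hquad _).1]
    simp only [fun a => (hquad a).2]
    rw [trace_smul, smul_eq_mul, inv_mul_eq_div, div_lt_iff₀ hn0'] at hn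
    have htrace : ((X n)ᵀ * X n).trace = ∑ j, ∑ i, X n i j ^ 2 := by
      simp [trace, Matrix.mul_apply, sq]
    rw [← htrace]
    simp only [one_pow, Finset.sum_const, Finset.card_univ, Fintype.card_fin, nsmul_eq_mul,
      mul_one]
    linarith
  set Z : Ω → ℝ := fun ω =>
    ∑ j, ((fun i => X n i j) ⬝ᵥ ε n ω) ^ 2 + ((fun _ => (1 : ℝ)) ⬝ᵥ ε n ω) ^ 2 with hZ
  have hZ0 : 0 ≤ᵐ[P] Z := ae_of_all _ fun ω =>
    add_nonneg (Finset.sum_nonneg fun j _ => sq_nonneg _) (sq_nonneg _)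
  have hmarkov := mul_meas_ge_le_integral_of_nonneg hZ0
    (hint.add (hquad fun _ => 1).1) (C / η * n)
  have hreal : P.real {ω | C / η * n ≤ Z ω} ≤ η := by
    have h := hmarkov.trans hE
    rw [← le_div_iff₀' (by positivity)] at h
    refine h.trans_eq ?_
    field_simp
  calc P {ω | C / η * n < Z ω} ≤ P {ω | C / η * n ≤ Z ω} :=
        measure_mono fun ω (h : C / η * n < Z ω) => h.le
    _ = ENNReal.ofReal (P.real {ω | C / η * n ≤ Z ω}) := (ofReal_measureReal).symm
    _ ≤ ENNReal.ofReal η := ENNReal.ofReal_le_ofReal hreal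

lemma lt_measure_of_subset_union {Ω : Type*} [MeasurableSpace Ω] {P : Measure Ω}
    {A E N : Set Ω} {a : ℝ≥0∞} {η : ℝ} (ha : a ≠ ∞) (hη : 0 ≤ η) (haη : a.toReal + η = 1 - η)
    (hA : ENNReal.ofReal (1 - η) < P A) (hN : P N ≤ ENNReal.ofReal η) (h : A ⊆ E ∪ N) :
    a < P E := by
  by_contra! hle
  have hcover := (measure_mono h).trans (measure_union_le (μ := P) E N)
  refine (hA.trans_le hcover).not_ge ((add_le_add hle hN).trans_eq ?_)
  rw [← ENNReal.ofReal_toReal ha, ← ENNReal.ofReal_add ENNReal.toReal_nonneg hη, haη]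


/-- **Theorem 4, model selection consistency of BIC under spherically
symmetric errors.** For every `γ ≠ T` (the null model included) the ratio of BIC-based
Bayes factors `n^{(q_T-q_γ)/2}((1-R_T²)/(1-R_γ²))^{n/2}` tends to `0` in probability. -/
theorem bic_model_selection_consistency
    (p : ℕ) (hp : 1 ≤ p)
    (Ω : Type) [MeasurableSpace Ω] (P : Measure Ω) [IsProbabilityMeasure P]
    (X : (n : ℕ) → Matrix (Fin n) (Fin p) ℝ)
    (ε : (n : ℕ) → Ω → Fin n → ℝ)
    (horth : ∀ n j, ∑ i, X n i j = 0)
    (hA2 : ∃ S₀ : Matrix (Fin p) (Fin p) ℝ, S₀.PosDef ∧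
      Tendsto (fun n : ℕ => ((n : ℝ)⁻¹) • ((X n)ᵀ * X n)) atTop (nhds S₀))
    (hmeas : ∀ n, Measurable (ε n))
    (hsph : ∀ (n : ℕ) (O : Matrix (Fin n) (Fin n) ℝ), Oᵀ * O = 1 →
      P.map (fun ω => O.mulVec (ε n ω)) = P.map (ε n))
    (hmean : ∀ n i, ∫ ω, ε n ω i ∂P = 0)
    (hcov : ∀ n i j, ∫ ω, ε n ω i * ε n ω j ∂P = if i = j then 1 else 0)
    (hA1 : ∀ c : ℝ, 0 < c → ∃ M : ℝ, 1 < M ∧ ∀ n : ℕ, 0 < n →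
      ENNReal.ofReal (1 - c) <
        P {ω | M⁻¹ < (∑ i, ε n ω i ^ 2) / n ∧ (∑ i, ε n ω i ^ 2) / n < M})
    (T : Finset (Fin p)) (αT σT : ℝ) (hσ : 0 < σT)
    (βT : Fin p → ℝ) (hβT : ∀ j ∈ T, βT j ≠ 0) (hβT' : ∀ j ∉ T, βT j = 0)
    (γ : Finset (Fin p)) (hγT : γ ≠ T)
    :
    (∀ δ : ℝ, 0 < δ →
      Tendsto (fun n : ℕ =>
        P {ω | (∑ i, (yResp (X n) αT βT σT (ε n ω) i - (∑ l, yResp (X n) αT βT σT (ε n ω) l) / n) ^ 2) ≠ 0 ∧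
               RsqC (X n) γ (yResp (X n) αT βT σT (ε n ω)) < 1 ∧
               (n : ℝ) ^ (((T.card : ℝ) - γ.card) / 2) *
                 ((1 - RsqC (X n) T (yResp (X n) αT βT σT (ε n ω))) / (1 - RsqC (X n) γ (yResp (X n) αT βT σT (ε n ω)))) ^ ((n : ℝ) / 2)
                 ≤ δ})
        atTop (nhds 1)) := by
  obtain ⟨S₀, hS₀, hlim⟩ := hA2
  obtain ⟨c, hc, hgram⟩ := eventually_mul_norm_sq_le_gram hS₀ hlim
  intro δ hδ
  refine tendsto_order.2 ⟨fun a ha => ?_, fun a ha => Eventually.of_forall fun n =>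
    prob_le_one.trans_lt ha⟩
  have ha' : a.toReal < 1 := by
    rw [← ENNReal.toReal_one]
    exact (ENNReal.toReal_lt_toReal ha.ne_top ENNReal.one_ne_top).2 ha
  set η : ℝ := (1 - a.toReal) / 2 with hη
  have hη0 : 0 < η := by linarith
  obtain ⟨M, hM, hnoise⟩ := hA1 η hη0
  obtain ⟨K, hK, hscore⟩ := exists_measure_scores_gt_le hlim hmeas hcov hη0
  filter_upwards [eventually_bayesFactorRatio_le horth hc hgram αT hσ hβT hβT' hγT hM hK hδ,
    hscore, eventually_gt_atTop 0] with n hdet hn hn0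
  refine lt_measure_of_subset_union ha.ne_top hη0.le (by linarith) (hnoise n hn0) hn
    fun ω hω => ?_
  by_cases h : K * n < ∑ j, ((X n)ᵀ *ᵥ ε n ω) j ^ 2 + (∑ i, ε n ω i) ^ 2
  · exact Or.inr h
  · rw [not_lt] at h
    have h1 : 0 ≤ ∑ j, ((X n)ᵀ *ᵥ ε n ω) j ^ 2 := Finset.sum_nonneg fun j _ => sq_nonneg _
    exact Or.inl (hdet _ hω.1 hω.2 (by linarith [sq_nonneg (∑ i, ε n ω i)]) (by linarith))
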